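/- Suppose $Q = Q(\alpha,\beta,s,t,\upsilon)$ is the basic sequence $[[\alpha_1]^{s_1}[\beta_1]^{t_1}]^{\upsilon_1}[[\alpha_2]^{s_2}[\beta_2]^{t_2}]^{\upsilon_2}\cdots$, is infinite in limit and fully divergent, and satisfies: $\lim_n (s_n \log \alpha_n)/(\sum_{i<n} \upsilon_i t_i \log \beta_i) = 0$; $\lim_n (s_n\log\alpha_n)/(t_n\log\beta_n) = 0$; $\lim_n (t_n \alpha_n^k)/(s_n\beta_n^k) = 0$ for all $k \ge 1$; $\lim_n \alpha_n^k/s_n = 0$ for all $k$; $\lim_n (\sum_{i\le n}\upsilon_i s_i)/(\sum_{i\le n}\upsilon_i(s_i+t_i)) = 0$; and $\alpha_i = o(\beta_i)$. Then $\dim_H(\mathscr{N}(Q) \setminus \mathscr{DN}(Q)) = 1$. -/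

import Mathlib

open scoped Classical
open Filter MeasureTheory

noncomputable section

/-- Product of the first `n` bases of a basic sequence. -/
def cantorProd (q : ℕ → ℕ) (n : ℕ) : ℝ := ∏ i ∈ Finset.range n, (q i : ℝ)

/-- `E` is the sequence of digits of the `Q`-Cantor series expansion of `x`
(the digit `E n` is the digit `E_{n+1}` of the paper, in base `q n = q_{n+1}`). -/
def IsCantorExp (q : ℕ → ℕ) (x : ℝ) (E : ℕ → ℕ) : Prop :=
  (∀ n, E n < q n) ∧ (∀ m, ∃ n, m ≤ n ∧ E n ≠ q n - 1) ∧
  x = (⌊x⌋ : ℝ) + ∑' n, (E n : ℝ) / cantorProd q (n + 1)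

/-- Number of occurrences of the block `B` of length `k` among the first `n` digits. -/
def blockCount (E : ℕ → ℕ) (k : ℕ) (B : Fin k → ℕ) (n : ℕ) : ℕ :=
  ((Finset.range (n + 1 - k)).filter (fun j => ∀ i : Fin k, E (j + i) = B i)).card

/-- `Q_n^{(k)}`. -/
def Qnk (q : ℕ → ℕ) (k n : ℕ) : ℝ :=
  ∑ j ∈ Finset.range n, 1 / ∏ i ∈ Finset.range k, (q (j + i) : ℝ)

/-- `x` is `Q`-normal of order `k`. -/
def QNormalOrder (q : ℕ → ℕ) (k : ℕ) (x : ℝ) : Prop :=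
  ∃ E, IsCantorExp q x E ∧ ∀ B : Fin k → ℕ,
    Tendsto (fun n => (blockCount E k B n : ℝ) / Qnk q k n) atTop (nhds 1)

/-- `x` is `Q`-ratio normal of order `k`. -/
def QRatioNormalOrder (q : ℕ → ℕ) (k : ℕ) (x : ℝ) : Prop :=
  ∃ E, IsCantorExp q x E ∧ ∀ B₁ B₂ : Fin k → ℕ,
    Tendsto (fun n => (blockCount E k B₁ n : ℝ) / (blockCount E k B₂ n : ℝ))
      atTop (nhds 1)

/-- A sequence of reals is uniformly distributed mod 1. -/
def UDMod1 (u : ℕ → ℝ) : Prop :=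
  ∀ a b : ℝ, 0 ≤ a → a ≤ b → b ≤ 1 →
    Tendsto
      (fun N => (((Finset.range N).filter
          (fun n => Int.fract (u n) ∈ Set.Ico a b)).card : ℝ) / N)
      atTop (nhds (b - a))

/-- `x` is `Q`-distribution normal. -/
def QDistNormal (q : ℕ → ℕ) (x : ℝ) : Prop :=
  UDMod1 (fun n => cantorProd q n * x)

/-- Length of the `i`-th super-block `[[α_i]^{s_i}[β_i]^{t_i}]^{υ_i}`. -/
def sblockLen (s t υ : ℕ → ℕ) (i : ℕ) : ℕ := υ i * (s i + t i)

/-- Total length of the first `i` super-blocks. -/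
def cumLen (s t υ : ℕ → ℕ) (i : ℕ) : ℕ :=
  ∑ j ∈ Finset.range i, sblockLen s t υ j

/-- `q` is the concatenation `[[α_1]^{s_1}[β_1]^{t_1}]^{υ_1} [[α_2]^{s_2}[β_2]^{t_2}]^{υ_2} ⋯`
(with all sequences indexed from `0`). -/
def IsQConcat (α β s t υ q : ℕ → ℕ) : Prop :=
  ∀ i c d : ℕ, c < υ i →
    (d < s i → q (cumLen s t υ i + c * (s i + t i) + d) = α i) ∧
    (d < t i → q (cumLen s t υ i + c * (s i + t i) + s i + d) = β i)

/-- `n` is a position of the concatenation coming from an `α`-run. -/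
def alphaPos (s t υ : ℕ → ℕ) (n : ℕ) : Prop :=
  ∃ i c d : ℕ, c < υ i ∧ d < s i ∧ n = cumLen s t υ i + c * (s i + t i) + d

/-- The number of `α`-positions before position `n`. -/
def alphaIdx (s t υ : ℕ → ℕ) (n : ℕ) : ℕ :=
  ((Finset.range n).filter (alphaPos s t υ)).card

/-- The set `Θ(α, β, s, t, υ, F, I)`: reals whose `Q`-Cantor digits equal the
prescribed digit from `F` at each `α`-position and lie in `I i` at each
`β`-position of the `i`-th super-block. -/
def Theta (s t υ : ℕ → ℕ) (F : ℕ → ℕ) (I : ℕ → Finset ℕ) (q : ℕ → ℕ) :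
    Set ℝ :=
  {x : ℝ | ∃ E : ℕ → ℕ, IsCantorExp q x E ∧
    ∀ i c d : ℕ, c < υ i →
      (d < s i → E (cumLen s t υ i + c * (s i + t i) + d)
        = F (alphaIdx s t υ (cumLen s t υ i + c * (s i + t i) + d))) ∧
      (d < t i → E (cumLen s t υ i + c * (s i + t i) + s i + d) ∈ I i)}

theorem aux_interp (S m : ℕ → ℝ) (hS : Monotone S) (hS0 : ∀ n, 0 ≤ S n) (hm : Monotone m)
    (hm0 : m 0 = 0) (hm1 : ∀ n, m (n + 1) ≤ m n + 1) (hmt : Tendsto m atTop atTop)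
    (g : ℕ → ℕ) (hg1 : ∀ r : ℕ, (r : ℝ) ^ 2 ≤ m (g r)) (hg2 : ∀ r : ℕ, m (g r) ≤ (r : ℝ) ^ 2 + 1)
    (hg3 : ∀ r n : ℕ, (r : ℝ) ^ 2 ≤ m n → g r ≤ n)
    (hlim : Tendsto (fun r => S (g r) / m (g r)) atTop (nhds 1)) :
    Tendsto (fun n => S n / m n) atTop (nhds 1) := by
  have hmn : ∀ n, 0 ≤ m n := fun n => hm0 ▸ hm (Nat.zero_le n)
  have hinv : Tendsto (fun r : ℕ => 1 / ((r : ℝ) + 1)) atTop (nhds 0) :=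
    tendsto_one_div_add_atTop_nhds_zero_nat
  have hinv0 : Tendsto (fun r : ℕ => 1 / (r : ℝ)) atTop (nhds 0) :=
    tendsto_one_div_atTop_nhds_zero_nat
  -- comparison sequences
  have hA : Tendsto (fun r : ℕ => m (g r) / (r : ℝ) ^ 2) atTop (nhds 1) := by
    have h1 : Tendsto (fun r : ℕ => 1 + (1 / (r : ℝ)) ^ 2) atTop (nhds 1) := by
      simpa using (hinv0.pow 2).const_add 1
    refine tendsto_of_tendsto_of_tendsto_of_le_of_le' tendsto_const_nhds h1 ?_ ?_
    · filter_upwards [eventually_gt_atTop 0] with r hr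
      have : (0 : ℝ) < r := by exact_mod_cast hr
      rw [le_div_iff₀ (by positivity)]
      simpa using hg1 r
    · filter_upwards [eventually_gt_atTop 0] with r hr
      have : (0 : ℝ) < r := by exact_mod_cast hr
      rw [div_le_iff₀ (by positivity)]
      refine (hg2 r).trans (le_of_eq ?_)
      field_simp
  have hB : Tendsto (fun r : ℕ => (r : ℝ) ^ 2 / ((r : ℝ) + 1) ^ 2) atTop (nhds 1) := by
    have h1 : Tendsto (fun r : ℕ => (1 - 1 / ((r : ℝ) + 1)) ^ 2) atTop (nhds 1) := by
      simpa using (hinv.const_sub 1).pow 2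
    refine h1.congr fun r => ?_
    have : (0 : ℝ) < r + 1 := by positivity
    field_simp
    ring
  have hlow : Tendsto (fun r : ℕ => S (g r) / ((r : ℝ) + 1) ^ 2) atTop (nhds 1) := by
    have := (hlim.mul hA).mul hB
    simp only [mul_one] at this
    refine this.congr' ?_
    filter_upwards [eventually_gt_atTop 0] with r hr
    have h0 : (0 : ℝ) < r := by exact_mod_cast hr
    have h1 : 0 < m (g r) := lt_of_lt_of_le (by positivity) (hg1 r)
    field_simp
  have hup : Tendsto (fun r : ℕ => S (g (r + 1)) / (r : ℝ) ^ 2) atTop (nhds 1) := by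
    have h1 := (tendsto_add_atTop_iff_nat 1).2 (hlim.mul hA)
    have h2 : Tendsto (fun r : ℕ => ((r : ℝ) ^ 2 / ((r : ℝ) + 1) ^ 2)⁻¹) atTop (nhds 1) := by
      simpa using hB.inv₀ one_ne_zero
    have := h1.mul h2
    simp only [mul_one] at this
    refine this.congr' ?_
    filter_upwards [eventually_gt_atTop 0] with r hr
    have h0 : (0 : ℝ) < r := by exact_mod_cast hr
    have h1 : 0 < m (g (r + 1)) := lt_of_lt_of_le (by positivity) (hg1 (r + 1))
    push_cast
    field_simp
  let ρ : ℕ → ℕ := fun n => ⌊Real.sqrt (m n)⌋₊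
  have hρ : Tendsto ρ atTop atTop :=
    tendsto_nat_floor_atTop.comp (Real.tendsto_sqrt_atTop.comp hmt)
  have e1 : ∀ n, ((ρ n : ℕ) : ℝ) ^ 2 ≤ m n := fun n => by
    have := Nat.floor_le (Real.sqrt_nonneg (m n))
    calc ((ρ n : ℕ) : ℝ) ^ 2 ≤ (Real.sqrt (m n)) ^ 2 := by gcongr
      _ = m n := Real.sq_sqrt (hmn n)
  have e2 : ∀ n, m n < ((ρ n : ℕ) + 1 : ℝ) ^ 2 := fun n => by
    have := Nat.lt_floor_add_one (Real.sqrt (m n))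
    calc m n = (Real.sqrt (m n)) ^ 2 := (Real.sq_sqrt (hmn n)).symm
      _ < _ := by gcongr
  refine tendsto_of_tendsto_of_tendsto_of_le_of_le' (hlow.comp hρ) (hup.comp hρ) ?_ ?_
  · filter_upwards [hmt.eventually_gt_atTop 0] with n hn
    simp only [Function.comp]
    have := hS (hg3 _ _ (e1 n))
    exact div_le_div₀ (hS0 _) this hn (e2 n).le
  · filter_upwards [hρ.eventually_gt_atTop 0] with n hn
    simp only [Function.comp]
    have h0 : (0 : ℝ) < ρ n := by exact_mod_cast hn
    have : n ≤ g (ρ n + 1) := by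
      by_contra hc
      push Not at hc
      have h3 := hm hc.le
      have h4 := hg1 (ρ n + 1)
      push_cast at h4
      linarith [e2 n]
    exact div_le_div₀ (hS0 _) (hS this) (by positivity) (e1 n)

theorem aux_var {Ω : Type*} [MeasurableSpace Ω] (μ : Measure Ω) [IsProbabilityMeasure μ]
    (A : ℕ → Set Ω) (hA : ∀ i, MeasurableSet (A i)) (k : ℕ)
    (hind : ∀ i j, i + k ≤ j → μ.real (A i ∩ A j) = μ.real (A i) * μ.real (A j)) (n : ℕ) :
    ∫ ω, ((∑ i ∈ Finset.range n, (A i).indicator (1 : Ω → ℝ) ω)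
      - ∑ i ∈ Finset.range n, μ.real (A i)) ^ 2 ∂μ
      ≤ 2 * k * ∑ i ∈ Finset.range n, μ.real (A i) := by
  set p : ℕ → ℝ := fun i => μ.real (A i) with hp
  have hint : ∀ s : Set Ω, MeasurableSet s → Integrable (s.indicator (1 : Ω → ℝ)) μ :=
    fun s hs => (integrable_const (1 : ℝ)).indicator hs
  have hexp : ∀ ω, ((∑ i ∈ Finset.range n, (A i).indicator (1 : Ω → ℝ) ω)
      - ∑ i ∈ Finset.range n, p i) ^ 2 =
      ∑ i ∈ Finset.range n, ∑ j ∈ Finset.range n, ((A i ∩ A j).indicator (1 : Ω → ℝ) ω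
        - p j * (A i).indicator (1 : Ω → ℝ) ω - p i * (A j).indicator (1 : Ω → ℝ) ω
        + p i * p j) := by
    intro ω
    rw [← Finset.sum_sub_distrib, sq, Finset.sum_mul_sum]
    refine Finset.sum_congr rfl fun i _ => Finset.sum_congr rfl fun j _ => ?_
    rw [Set.inter_indicator_one]
    simp only [Pi.mul_apply]
    ring
  have hi2 : ∀ i j, Integrable (fun ω => (A i ∩ A j).indicator (1 : Ω → ℝ) ω
        - p j * (A i).indicator (1 : Ω → ℝ) ω - p i * (A j).indicator (1 : Ω → ℝ) ω
        + p i * p j) μ := fun i j =>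
    (((hint _ ((hA i).inter (hA j))).sub ((hint _ (hA i)).const_mul _)).sub
      ((hint _ (hA j)).const_mul _)).add (integrable_const _)
  have hterm : ∀ i j, ∫ ω, ((A i ∩ A j).indicator (1 : Ω → ℝ) ω
        - p j * (A i).indicator (1 : Ω → ℝ) ω - p i * (A j).indicator (1 : Ω → ℝ) ω
        + p i * p j) ∂μ = μ.real (A i ∩ A j) - p i * p j := by
    intro i j
    rw [integral_add, integral_sub, integral_sub, integral_const_mul, integral_const_mul,
      integral_indicator_one ((hA i).inter (hA j)), integral_indicator_one (hA i),
      integral_indicator_one (hA j)]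
    · simp [hp]
      ring
    · exact hint _ ((hA i).inter (hA j))
    · exact (hint _ (hA i)).const_mul _
    · exact (hint _ ((hA i).inter (hA j))).sub ((hint _ (hA i)).const_mul _)
    · exact (hint _ (hA j)).const_mul _
    · exact ((hint _ ((hA i).inter (hA j))).sub ((hint _ (hA i)).const_mul _)).sub
        ((hint _ (hA j)).const_mul _)
    · exact integrable_const _
  simp_rw [hexp]
  rw [integral_finsetSum _ fun i _ => integrable_finsetSum _ fun j _ => hi2 i j]
  simp_rw [integral_finsetSum (Finset.range n) fun j _ => hi2 _ j, hterm]
  rw [Finset.mul_sum]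
  refine Finset.sum_le_sum fun i _ => ?_
  have hp0 : ∀ i, 0 ≤ p i := fun i => measureReal_nonneg
  calc ∑ j ∈ Finset.range n, (μ.real (A i ∩ A j) - p i * p j)
      ≤ ∑ j ∈ Finset.range n, (if j ∈ Finset.Ico (i - k) (i + k) then p i else 0) := by
        refine Finset.sum_le_sum fun j _ => ?_
        split_ifs with h
        · have : μ.real (A i ∩ A j) ≤ p i := measureReal_mono Set.inter_subset_left
          nlinarith [mul_nonneg (hp0 i) (hp0 j)]
        · simp only [Finset.mem_Ico, not_and_or, not_le, not_lt] at h
          rcases h with h | h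
          · rw [Set.inter_comm, hind j i (by omega)]
            simp only [hp]; linarith
          · rw [hind i j h]
            simp only [hp]; linarith
    _ = ∑ j ∈ (Finset.range n).filter (fun j => j ∈ Finset.Ico (i - k) (i + k)), p i := by
        rw [Finset.sum_filter]
    _ ≤ ∑ j ∈ Finset.Ico (i - k) (i + k), p i := by
        refine Finset.sum_le_sum_of_subset_of_nonneg ?_ fun _ _ _ => hp0 i
        intro j hj
        exact (Finset.mem_filter.1 hj).2
    _ ≤ 2 * k * p i := by
        rw [Finset.sum_const, nsmul_eq_mul, Nat.card_Ico]
        refine mul_le_mul_of_nonneg_right ?_ (hp0 i)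
        have : i + k - (i - k) ≤ 2 * k := by omega
        exact_mod_cast this

theorem aux_slln {Ω : Type*} [MeasurableSpace Ω] (μ : Measure Ω) [IsProbabilityMeasure μ]
    (A : ℕ → Set Ω) (hA : ∀ i, MeasurableSet (A i)) (k : ℕ)
    (hind : ∀ i j, i + k ≤ j → μ.real (A i ∩ A j) = μ.real (A i) * μ.real (A j))
    (hdiv : Tendsto (fun n => ∑ i ∈ Finset.range n, μ.real (A i)) atTop atTop) :
    ∀ᵐ ω ∂μ, Tendsto (fun n => (∑ i ∈ Finset.range n, (A i).indicator (1 : Ω → ℝ) ω) /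
      ∑ i ∈ Finset.range n, μ.real (A i)) atTop (nhds 1) := by
  set m : ℕ → ℝ := fun n => ∑ i ∈ Finset.range n, μ.real (A i) with hm
  set S : ℕ → Ω → ℝ := fun n ω => ∑ i ∈ Finset.range n, (A i).indicator (1 : Ω → ℝ) ω with hS
  have hex : ∀ r : ℕ, ∃ n, (r : ℝ) ^ 2 ≤ m n := fun r =>
    (hdiv.eventually_ge_atTop ((r : ℝ) ^ 2)).exists
  have hm1 : ∀ n, m (n + 1) ≤ m n + 1 := fun n => by
    simp only [hm, Finset.sum_range_succ]
    have : μ.real (A n) ≤ 1 := measureReal_le_one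
    linarith
  have hmm : Monotone m := monotone_nat_of_le_succ fun n => by
    simp only [hm, Finset.sum_range_succ]
    have : 0 ≤ μ.real (A n) := measureReal_nonneg
    linarith
  have hm0 : m 0 = 0 := by simp [hm]
  let g : ℕ → ℕ := fun r => Nat.find (hex r)
  have hg1 : ∀ r : ℕ, (r : ℝ) ^ 2 ≤ m (g r) := fun r => Nat.find_spec (hex r)
  have hg3 : ∀ r n : ℕ, (r : ℝ) ^ 2 ≤ m n → g r ≤ n := fun r n h => Nat.find_min' (hex r) h
  have hg2 : ∀ r : ℕ, m (g r) ≤ (r : ℝ) ^ 2 + 1 := by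
    intro r
    rcases Nat.eq_zero_or_pos (g r) with h | h
    · rw [h, hm0]; positivity
    · obtain ⟨l, hl⟩ : ∃ l, g r = l + 1 := ⟨g r - 1, by omega⟩
      have h1 : ¬ ((r : ℝ) ^ 2 ≤ m l) := fun hc => by
        have := hg3 r l hc
        omega
      push Not at h1
      rw [hl]
      linarith [hm1 l]
  have hSmeas : ∀ n, Measurable (S n) := fun n =>
    Finset.measurable_sum _ fun i _ => measurable_one.indicator (hA i)
  have hind01 : ∀ i ω, 0 ≤ (A i).indicator (1 : Ω → ℝ) ω ∧ (A i).indicator (1 : Ω → ℝ) ω ≤ 1 := by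
    intro i ω
    by_cases h : ω ∈ A i <;> simp [h]
  have hS0 : ∀ n ω, 0 ≤ S n ω := fun n ω => Finset.sum_nonneg fun i _ => (hind01 i ω).1
  have hSn : ∀ n ω, S n ω ≤ n := fun n ω => by
    calc S n ω ≤ ∑ i ∈ Finset.range n, (1 : ℝ) := Finset.sum_le_sum fun i _ => (hind01 i ω).2
      _ = n := by simp
  have hmn : ∀ n, 0 ≤ m n := fun n => hm0 ▸ hmm (Nat.zero_le n)
  let D : ℕ → Ω → ℝ := fun r ω => ((S (g r) ω - m (g r)) / m (g r)) ^ 2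
  have hDmeas : ∀ r, Measurable (D r) := fun r =>
    (((hSmeas _).sub_const _).div_const _).pow_const 2
  have hDbound : ∀ r : ℕ, 0 < r → ∫⁻ ω, ENNReal.ofReal (D r ω) ∂μ ≤
      ENNReal.ofReal (2 * k / (r : ℝ) ^ 2) := by
    intro r hr
    have h0 : (0 : ℝ) < r := by exact_mod_cast hr
    have hmp : 0 < m (g r) := lt_of_lt_of_le (by positivity) (hg1 r)
    have hDi : Integrable (D r) μ := by
      refine Integrable.of_bound (hDmeas r).aestronglyMeasurable
        (((g r + m (g r)) / m (g r)) ^ 2) (Eventually.of_forall fun ω => ?_)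
      have h1 := hS0 (g r) ω
      have h2 := hSn (g r) ω
      simp only [D]
      rw [Real.norm_eq_abs, abs_of_nonneg (sq_nonneg _), div_pow, div_pow]
      gcongr ?_ / _
      refine sq_le_sq' ?_ ?_ <;> linarith [hmn (g r)]
    rw [← ofReal_integral_eq_lintegral_ofReal hDi (Eventually.of_forall fun ω => sq_nonneg _)]
    refine ENNReal.ofReal_le_ofReal ?_
    have hv := aux_var μ A hA k hind (g r)
    simp only [D, div_pow]
    rw [integral_div, div_le_iff₀ (by positivity)]
    refine hv.trans ?_
    change 2 * k * m (g r) ≤ _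
    have h2 : m (g r) * (r : ℝ) ^ 2 ≤ m (g r) ^ 2 := by nlinarith [hg1 r]
    rw [div_mul_eq_mul_div, le_div_iff₀ (by positivity)]
    have : (0 : ℝ) ≤ 2 * k := by positivity
    nlinarith
  have hfin : ∫⁻ ω, ∑' r : ℕ, ENNReal.ofReal (D (r + 1) ω) ∂μ ≠ ⊤ := by
    rw [lintegral_tsum fun r => (hDmeas _).ennreal_ofReal.aemeasurable]
    have hsum : Summable fun r : ℕ => 2 * k / ((r + 1 : ℕ) : ℝ) ^ 2 := by
      have := (summable_nat_add_iff 1).2 (Real.summable_one_div_nat_pow.2 (by norm_num : 1 < 2))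
      refine (this.mul_left (2 * (k : ℝ))).congr fun r => ?_
      rw [mul_one_div]
    have h2 := hsum.tsum_ofReal_ne_top
    exact ne_top_of_le_ne_top h2 (ENNReal.tsum_le_tsum fun r => hDbound (r + 1) (Nat.succ_pos r))
  have hae := ae_lt_top' (AEMeasurable.tsum fun r =>
    (hDmeas (r + 1)).ennreal_ofReal.aemeasurable) hfin
  filter_upwards [hae] with ω hω
  have ht := ENNReal.tendsto_atTop_zero_of_tsum_ne_top hω.ne
  have ht2 : Tendsto (fun r : ℕ => D (r + 1) ω) atTop (nhds 0) := by
    have := (ENNReal.tendsto_toReal ENNReal.zero_ne_top).comp ht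
    refine this.congr fun r => ?_
    simp only [Function.comp]
    exact ENNReal.toReal_ofReal (sq_nonneg _)
  have ht3 : Tendsto (fun r : ℕ => (S (g r) ω - m (g r)) / m (g r)) atTop (nhds 0) := by
    rw [← tendsto_add_atTop_iff_nat 1]
    have := (Real.continuous_sqrt.tendsto 0).comp ht2
    rw [Real.sqrt_zero] at this
    rw [tendsto_zero_iff_abs_tendsto_zero]
    refine this.congr fun r => ?_
    simp only [Function.comp, D]
    exact Real.sqrt_sq_eq_abs _
  have ht4 : Tendsto (fun r : ℕ => S (g r) ω / m (g r)) atTop (nhds 1) := by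
    have := ht3.add_const 1
    rw [zero_add] at this
    refine this.congr' ?_
    filter_upwards [eventually_gt_atTop 0] with r hr
    have h0 : (0 : ℝ) < r := by exact_mod_cast hr
    have hmp : 0 < m (g r) := lt_of_lt_of_le (by positivity) (hg1 r)
    field_simp
    ring
  refine aux_interp (fun n => S n ω) m ?_ (fun n => hS0 n ω) hmm hm0 hm1 hdiv g hg1 hg2 hg3 ht4
  refine monotone_nat_of_le_succ fun n => ?_
  simp only [hS, Finset.sum_range_succ]
  linarith [(hind01 n ω).1]

def cval (q : ℕ → ℕ) (E : ℕ → ℕ) : ℝ := ∑' n, (E n : ℝ) / cantorProd q (n + 1)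

def cN (q : ℕ → ℕ) (E : ℕ → ℕ) : ℕ → ℕ
  | 0 => 0
  | n + 1 => q n * cN q E n + E n

theorem cP_succ (q : ℕ → ℕ) (n : ℕ) : cantorProd q (n + 1) = cantorProd q n * q n := by
  simp [cantorProd, Finset.prod_range_succ]

theorem cP_pos {q : ℕ → ℕ} (hq : ∀ n, 2 ≤ q n) (n : ℕ) : 0 < cantorProd q n :=
  Finset.prod_pos fun i _ => by have := hq i; positivity

theorem cP_succ' (q : ℕ → ℕ) (n : ℕ) :
    cantorProd q (n + 1) = q 0 * cantorProd (fun i => q (i + 1)) n := by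
  simp [cantorProd, Finset.prod_range_succ', mul_comm]

theorem cval_partial {q E : ℕ → ℕ} (hq : ∀ n, 2 ≤ q n) (hE : ∀ n, E n < q n) (M : ℕ) :
    ∑ n ∈ Finset.range M, (E n : ℝ) / cantorProd q (n + 1) ≤ 1 - 1 / cantorProd q M := by
  induction M with
  | zero => simp [cantorProd]
  | succ M ih =>
    rw [Finset.sum_range_succ]
    have hp := cP_pos hq M
    have hqp : (0 : ℝ) < q M := by have := hq M; positivity
    have h1 : (E M : ℝ) + 1 ≤ q M := by exact_mod_cast hE M
    have : (E M : ℝ) / cantorProd q (M + 1) ≤ 1 / cantorProd q M - 1 / cantorProd q (M + 1) := by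
      rw [cP_succ]
      have e : 1 / cantorProd q M = q M / (cantorProd q M * q M) := by field_simp
      rw [e, ← sub_div]
      gcongr
      linarith
    linarith

theorem cval_term_nonneg {q : ℕ → ℕ} (hq : ∀ n, 2 ≤ q n) (E : ℕ → ℕ) (n : ℕ) :
    0 ≤ (E n : ℝ) / cantorProd q (n + 1) := div_nonneg (Nat.cast_nonneg _) (cP_pos hq _).le

theorem cval_partial_le {q E : ℕ → ℕ} (hq : ∀ n, 2 ≤ q n) (hE : ∀ n, E n < q n) (M : ℕ) :
    ∑ n ∈ Finset.range M, (E n : ℝ) / cantorProd q (n + 1) ≤ 1 := by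
  have h := cval_partial hq hE M
  have : 0 ≤ 1 / cantorProd q M := by have := cP_pos hq M; positivity
  linarith

theorem cval_summable {q E : ℕ → ℕ} (hq : ∀ n, 2 ≤ q n) (hE : ∀ n, E n < q n) :
    Summable fun n => (E n : ℝ) / cantorProd q (n + 1) :=
  summable_of_sum_range_le (cval_term_nonneg hq E) (cval_partial_le hq hE)

theorem cval_nonneg {q : ℕ → ℕ} (hq : ∀ n, 2 ≤ q n) (E : ℕ → ℕ) : 0 ≤ cval q E :=
  tsum_nonneg (cval_term_nonneg hq E)

theorem cval_le_one {q E : ℕ → ℕ} (hq : ∀ n, 2 ≤ q n) (hE : ∀ n, E n < q n) : cval q E ≤ 1 :=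
  Real.tsum_le_of_sum_range_le (cval_term_nonneg hq E) (cval_partial_le hq hE)

theorem cval_rec {q E : ℕ → ℕ} (hq : ∀ n, 2 ≤ q n) (hE : ∀ n, E n < q n) :
    q 0 * cval q E = E 0 + cval (fun i => q (i + 1)) (fun i => E (i + 1)) := by
  have hq0 : (q 0 : ℝ) ≠ 0 := by have := hq 0; positivity
  unfold cval
  rw [(cval_summable hq hE).tsum_eq_zero_add, mul_add, ← tsum_mul_left]
  congr 1
  · simp [cantorProd]
    field_simp
  · refine tsum_congr fun n => ?_
    rw [cP_succ' q (n + 1)]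
    have := (cP_pos (q := fun i => q (i + 1)) (fun i => hq (i + 1)) (n + 1)).ne'
    field_simp

theorem cval_split {q E : ℕ → ℕ} (hq : ∀ n, 2 ≤ q n) (hE : ∀ n, E n < q n) (n : ℕ) :
    cantorProd q n * cval q E = cN q E n + cval (fun i => q (i + n)) (fun i => E (i + n)) := by
  induction n with
  | zero => simp [cantorProd, cN]
  | succ n ih =>
    have h := cval_rec (q := fun i => q (i + n)) (E := fun i => E (i + n))
      (fun i => hq _) (fun i => hE _)
    simp only [zero_add] at h
    rw [cP_succ, mul_right_comm, ih, add_mul, mul_comm _ (q n : ℝ), mul_comm _ (q n : ℝ), h]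
    simp only [cN, Nat.cast_add, Nat.cast_mul, add_assoc, add_comm n 1]

theorem cN_inj {q E E' : ℕ → ℕ} (hE : ∀ n, E n < q n) (hE' : ∀ n, E' n < q n) (n : ℕ)
    (h : cN q E n = cN q E' n) : ∀ m < n, E m = E' m := by
  induction n with
  | zero => intro m hm; omega
  | succ n ih =>
    simp only [cN] at h
    have h1 : E n = E' n := by
      have := congrArg (· % q n) h
      simpa [Nat.mul_add_mod, Nat.mod_eq_of_lt (hE n), Nat.mod_eq_of_lt (hE' n)] using this
    have h2 : cN q E n = cN q E' n := by
      rw [h1] at h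
      have := hE n
      exact Nat.eq_of_mul_eq_mul_left (by omega) (Nat.add_right_cancel h)
    intro m hm
    rcases Nat.lt_succ_iff_lt_or_eq.1 hm with hm | rfl
    · exact ih h2 m hm
    · exact h1

/-- Digit sequences avoiding the top quarter of digits. -/
def GoodDig (q E : ℕ → ℕ) : Prop := ∀ n, E n < q n - q n / 4

theorem GoodDig.lt {q E : ℕ → ℕ} (h : GoodDig q E) (n : ℕ) : E n < q n :=
  lt_of_lt_of_le (h n) (Nat.sub_le _ _)

theorem good_tail {q E : ℕ → ℕ} (hq : ∀ n, 2 ≤ q n) (h : GoodDig q E) (n : ℕ) (hn : 7 ≤ q n) :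
    cval (fun i => q (i + n)) (fun i => E (i + n)) < 7 / 8 := by
  have h1 := cval_rec (q := fun i => q (i + n)) (E := fun i => E (i + n))
      (fun i => hq _) (fun i => h.lt _)
  have h2 := cval_le_one (q := fun i => q (i + 1 + n)) (E := fun i => E (i + 1 + n))
      (fun i => hq _) (fun i => h.lt _)
  simp only [zero_add] at h1
  have h3 : 8 * (E n + 1) < 7 * q n := by
    have := h n
    omega
  have h4 : 8 * ((E n : ℝ) + 1) < 7 * q n := by exact_mod_cast h3
  have h5 : (7 : ℝ) ≤ q n := by exact_mod_cast hn
  by_contra hc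
  push Not at hc
  nlinarith

theorem good_frac {q E : ℕ → ℕ} (hq : ∀ n, 2 ≤ q n) (h : GoodDig q E) (n : ℕ) (hn : 7 ≤ q n) :
    Int.fract (cantorProd q n * cval q E) < 7 / 8 := by
  have h1 := good_tail hq h n hn
  have h0 := cval_nonneg (q := fun i => q (i + n)) (fun i => hq _) (fun i => E (i + n))
  rw [cval_split hq h.lt n, Int.fract_natCast_add, Int.fract_eq_self.2 ⟨h0, by linarith⟩]
  exact h1

theorem cN_lt {q E : ℕ → ℕ} (hE : ∀ n, E n < q n) (n : ℕ) :
    (cN q E n : ℝ) + 1 ≤ cantorProd q n := by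
  have : cN q E n + 1 ≤ ∏ i ∈ Finset.range n, q i := by
    induction n with
    | zero => simp [cN]
    | succ n ih =>
      rw [Finset.prod_range_succ, cN]
      have := hE n
      have := Nat.mul_le_mul_right (q n) ih
      nlinarith
  unfold cantorProd
  exact_mod_cast this

theorem good_exp {q E : ℕ → ℕ} (hq : ∀ n, 2 ≤ q n) (hlim : Tendsto q atTop atTop)
    (h : GoodDig q E) : IsCantorExp q (cval q E) E := by
  refine ⟨h.lt, ?_, ?_⟩
  · intro m
    obtain ⟨n, h1, h2⟩ := ((hlim.eventually_ge_atTop 7).and (eventually_ge_atTop m)).exists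
    refine ⟨n, h2, ?_⟩
    have := h n
    omega
  · obtain ⟨n, hn⟩ := (hlim.eventually_ge_atTop 7).exists
    have h1 := good_tail hq h n hn
    have h2 := cN_lt h.lt n
    have h3 := cval_split hq h.lt n
    have h4 := cP_pos hq n
    have h5 : cval q E < 1 := by
      by_contra hc
      push Not at hc
      nlinarith
    have : ⌊cval q E⌋ = 0 := Int.floor_eq_zero_iff.2 ⟨cval_nonneg hq E, h5⟩
    rw [this]
    simp [cval]

theorem good_not_dist {q E : ℕ → ℕ} (hq : ∀ n, 2 ≤ q n) (hlim : Tendsto q atTop atTop)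
    (h : GoodDig q E) : ¬ QDistNormal q (cval q E) := by
  intro hd
  have h1 := hd (7 / 8) 1 (by norm_num) (by norm_num) le_rfl
  obtain ⟨n0, hn0⟩ := eventually_atTop.1 (hlim.eventually_ge_atTop 7)
  have h2 : Tendsto (fun N : ℕ => (n0 : ℝ) / N) atTop (nhds 0) :=
    tendsto_const_div_atTop_nhds_zero_nat _
  have h3 := le_of_tendsto_of_tendsto' h1 h2 fun N => by
    refine div_le_div_of_nonneg_right ?_ (Nat.cast_nonneg _)
    have : ((Finset.range N).filter (fun n => Int.fract (cantorProd q n * cval q E)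
        ∈ Set.Ico (7 / 8 : ℝ) 1)) ⊆ Finset.range n0 := by
      intro n hn
      rw [Finset.mem_filter] at hn
      rw [Finset.mem_range]
      by_contra hc
      push Not at hc
      have := good_frac hq h n (hn0 n hc)
      linarith [hn.2.1]
    have := Finset.card_le_card this
    rw [Finset.card_range] at this
    exact_mod_cast this
  norm_num at h3

/-! The digit law. -/

def wt (q b : ℕ) : ENNReal :=
  if b < q - 2 * (q / 4) then (q : ENNReal)⁻¹ else if b < q - q / 4 then 2 * (q : ENNReal)⁻¹ else 0

theorem wt_sum (q : ℕ) (hq : 0 < q) : ∑ b ∈ Finset.range (q - q / 4), wt q b = 1 := by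
  have e : q - q / 4 = (q - 2 * (q / 4)) + q / 4 := by omega
  have hs : ∑ b ∈ Finset.range (q - q / 4), wt q b
      = ((q - 2 * (q / 4) : ℕ) + 2 * (q / 4 : ℕ)) * (q : ENNReal)⁻¹ := by
    rw [e, Finset.sum_range_add, add_mul]
    congr 1
    · rw [Finset.sum_congr rfl (g := fun _ => (q : ENNReal)⁻¹)]
      · simp
      · intro b hb
        rw [Finset.mem_range] at hb
        simp [wt, hb]
    · rw [Finset.sum_congr rfl (g := fun _ => 2 * (q : ENNReal)⁻¹)]
      · simp
        ring
      · intro b hb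
        rw [Finset.mem_range] at hb
        rw [wt, if_neg (by omega), if_pos (by omega)]
  rw [hs]
  have : ((q - 2 * (q / 4) : ℕ) + 2 * (q / 4 : ℕ) : ENNReal) = q := by
    have : q - 2 * (q / 4) + 2 * (q / 4) = q := by omega
    exact_mod_cast congrArg (Nat.cast : ℕ → ENNReal) this
  rw [this]
  exact ENNReal.mul_inv_cancel (by exact_mod_cast hq.ne') (ENNReal.natCast_ne_top q)

theorem wt_zero (q b : ℕ) (h : b ∉ Finset.range (q - q / 4)) : wt q b = 0 := by
  rw [Finset.mem_range] at h
  rw [wt, if_neg (by omega), if_neg h]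

theorem wt_le (q b : ℕ) : wt q b ≤ 2 * (q : ENNReal)⁻¹ := by
  unfold wt
  split_ifs
  · exact le_mul_of_one_le_left zero_le (by norm_num)
  · exact le_rfl
  · exact zero_le

def law (q : ℕ) (hq : 2 ≤ q) : PMF ℕ :=
  PMF.ofFinset (wt q) (Finset.range (q - q / 4)) (wt_sum q (by omega)) (wt_zero q)

def mu (q : ℕ → ℕ) (hq : ∀ n, 2 ≤ q n) : Measure (ℕ → ℕ) :=
  Measure.infinitePi (fun n => (law (q n) (hq n)).toMeasure)

instance mu_prob (q : ℕ → ℕ) (hq : ∀ n, 2 ≤ q n) : IsProbabilityMeasure (mu q hq) := by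
  unfold mu; infer_instance

theorem mu_cyl (q : ℕ → ℕ) (hq : ∀ n, 2 ≤ q n) (s : Finset ℕ) (c : ℕ → ℕ) :
    mu q hq {ω | ∀ m ∈ s, ω m = c m} = ∏ m ∈ s, wt (q m) (c m) := by
  have : {ω : ℕ → ℕ | ∀ m ∈ s, ω m = c m} = Set.pi s (fun m => {c m}) := by
    ext ω; simp [Set.mem_pi]
  rw [this, mu, Measure.infinitePi_pi _ (fun i _ => measurableSet_singleton _)]
  refine Finset.prod_congr rfl fun m _ => ?_
  rw [PMF.toMeasure_apply_singleton _ _ (measurableSet_singleton _)]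
  rfl

theorem mu_good (q : ℕ → ℕ) (hq : ∀ n, 2 ≤ q n) : ∀ᵐ ω ∂(mu q hq), GoodDig q ω := by
  unfold GoodDig
  rw [ae_all_iff]
  intro n
  have : ∀ b : ℕ, ∀ᵐ ω ∂(mu q hq), q n - q n / 4 ≤ b → ω n ≠ b := by
    intro b
    by_cases hb : q n - q n / 4 ≤ b
    · have h1 := mu_cyl q hq {n} (fun _ => b)
      rw [Finset.prod_singleton, wt_zero _ _ (by simpa using hb)] at h1
      rw [ae_iff]
      simpa [hb] using h1
    · exact Eventually.of_forall fun _ h => absurd h hb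
  filter_upwards [ae_all_iff.2 this] with ω hω
  by_contra hc
  push Not at hc
  exact hω _ hc rfl

theorem blk_real (q : ℕ → ℕ) (hq : ∀ n, 2 ≤ q n) (k : ℕ) (b : ℕ → ℕ) (j : ℕ) :
    (mu q hq).real {ω | ∀ i < k, ω (j + i) = b i} =
      ∏ i ∈ Finset.range k, (wt (q (j + i)) (b i)).toReal := by
  have : {ω : ℕ → ℕ | ∀ i < k, ω (j + i) = b i}
      = {ω | ∀ m ∈ Finset.Ico j (j + k), ω m = b (m - j)} := by
    ext ω
    simp only [Set.mem_ofPred_eq, Finset.mem_Ico]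
    constructor
    · intro h m hm
      have := h (m - j) (by omega)
      rwa [Nat.add_sub_cancel' hm.1] at this
    · intro h i hi
      have := h (j + i) (by omega)
      rwa [Nat.add_sub_cancel_left] at this
  rw [this, Measure.real, mu_cyl, Finset.prod_Ico_eq_prod_range, ENNReal.toReal_prod]
  simp

theorem blk_indep (q : ℕ → ℕ) (hq : ∀ n, 2 ≤ q n) (k : ℕ) (b : ℕ → ℕ) (i j : ℕ) (hij : i + k ≤ j) :
    (mu q hq).real ({ω | ∀ l < k, ω (i + l) = b l} ∩ {ω | ∀ l < k, ω (j + l) = b l}) =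
      (mu q hq).real {ω | ∀ l < k, ω (i + l) = b l}
        * (mu q hq).real {ω | ∀ l < k, ω (j + l) = b l} := by
  have : ({ω : ℕ → ℕ | ∀ l < k, ω (i + l) = b l} ∩ {ω | ∀ l < k, ω (j + l) = b l})
      = {ω | ∀ m ∈ Finset.Ico i (i + k) ∪ Finset.Ico j (j + k),
          ω m = if m < i + k then b (m - i) else b (m - j)} := by
    ext ω
    simp only [Set.mem_inter_iff, Set.mem_ofPred_eq, Finset.mem_Ico, Finset.mem_union]
    constructor
    · rintro ⟨h1, h2⟩ m hm
      by_cases h : m < i + k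
      · rw [if_pos h]
        have := h1 (m - i) (by omega)
        rwa [Nat.add_sub_cancel' (by omega)] at this
      · rw [if_neg h]
        have := h2 (m - j) (by omega)
        rwa [Nat.add_sub_cancel' (by omega)] at this
    · intro h
      constructor
      · intro l hl
        have := h (i + l) (by omega)
        rwa [if_pos (by omega), Nat.add_sub_cancel_left] at this
      · intro l hl
        have := h (j + l) (by omega)
        rwa [if_neg (by omega), Nat.add_sub_cancel_left] at this
  rw [blk_real, blk_real, this, Measure.real, mu_cyl, Finset.prod_union, ENNReal.toReal_mul,
    Finset.prod_Ico_eq_prod_range, Finset.prod_Ico_eq_prod_range, ENNReal.toReal_prod,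
    ENNReal.toReal_prod]
  · simp only [Nat.add_sub_cancel_left]
    congr 1
    · refine Finset.prod_congr rfl fun l hl => ?_
      rw [Finset.mem_range] at hl
      rw [if_pos (by omega)]
    · refine Finset.prod_congr rfl fun l hl => ?_
      rw [if_neg (by omega)]
  · rw [Finset.disjoint_left]
    intro m h1 h2
    rw [Finset.mem_Ico] at h1 h2
    omega

theorem aux_ratio (S p Q : ℕ → ℝ) (bc : ℕ → ℝ) (c K : ℝ) 
    (hpQ : ∀ᶠ n in atTop, p n = Q n + c) (hQ : Tendsto Q atTop atTop)
    (hS : Tendsto (fun n => S n / p n) atTop (nhds 1))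
    (h1 : ∀ n, bc n ≤ S n) (h2 : ∀ n, S n - K ≤ bc n) :
    Tendsto (fun n => bc n / Q n) atTop (nhds 1) := by
  have hc : ∀ c : ℝ, Tendsto (fun n => c / Q n) atTop (nhds 0) := fun c => hQ.const_div_atTop c
  have hp : Tendsto (fun n => p n / Q n) atTop (nhds 1) := by
    have := (hc c).const_add 1
    rw [add_zero] at this
    refine this.congr' ?_
    filter_upwards [hpQ, hQ.eventually_gt_atTop 0] with n hn hq
    rw [hn]
    field_simp
  have hSQ : Tendsto (fun n => S n / Q n) atTop (nhds 1) := by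
    have := hS.mul hp
    rw [one_mul] at this
    refine this.congr' ?_
    filter_upwards [hpQ, hQ.eventually_gt_atTop (max 0 (-c))] with n hn hq
    have : 0 < p n := by rw [hn]; linarith [(le_max_right 0 (-c)).trans_lt hq]
    field_simp
  have hlo : Tendsto (fun n => S n / Q n - K / Q n) atTop (nhds 1) := by
    simpa using hSQ.sub (hc K)
  refine tendsto_of_tendsto_of_tendsto_of_le_of_le' hlo hSQ ?_ ?_
  · filter_upwards [hQ.eventually_gt_atTop 0] with n hq
    rw [← sub_div]
    exact div_le_div_of_nonneg_right (h2 n) hq.le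
  · filter_upwards [hQ.eventually_gt_atTop 0] with n hq
    exact div_le_div_of_nonneg_right (h1 n) hq.le

theorem ae_block (q : ℕ → ℕ) (hq : ∀ n, 2 ≤ q n) (hlim : Tendsto q atTop atTop) (k : ℕ)
    (hfull : Tendsto (fun n => Qnk q k n) atTop atTop) (B : Fin k → ℕ) :
    ∀ᵐ ω ∂(mu q hq), Tendsto (fun n => (blockCount ω k B n : ℝ) / Qnk q k n) atTop (nhds 1) := by
  let b : ℕ → ℕ := fun i => if h : i < k then B ⟨i, h⟩ else 0
  let A : ℕ → Set (ℕ → ℕ) := fun j => {ω | ∀ i < k, ω (j + i) = b i}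
  have hA : ∀ j, MeasurableSet (A j) := fun j => by
    have : A j = ⋂ i, ⋂ (_ : i < k), (fun ω : ℕ → ℕ => ω (j + i)) ⁻¹' {b i} := by
      ext ω; simp [A]
    rw [this]
    exact MeasurableSet.iInter fun i => MeasurableSet.iInter fun _ =>
      measurable_pi_apply _ (measurableSet_singleton _)
  have hpr : ∀ j, (mu q hq).real (A j) = ∏ i ∈ Finset.range k, (wt (q (j + i)) (b i)).toReal :=
    fun j => blk_real q hq k b j
  obtain ⟨n0, hn0⟩ : ∃ n0, ∀ n ≥ n0, ∀ i ∈ Finset.range k, 2 * b i + 1 ≤ q n := by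
    rw [← eventually_atTop, Finset.eventually_all]
    exact fun i _ => hlim.eventually_ge_atTop _
  have hpj : ∀ j ≥ n0, (mu q hq).real (A j) = 1 / ∏ i ∈ Finset.range k, (q (j + i) : ℝ) := by
    intro j hj
    rw [hpr, one_div, ← Finset.prod_inv_distrib]
    refine Finset.prod_congr rfl fun i hi => ?_
    have := hn0 (j + i) (by omega) i hi
    rw [wt, if_pos (by omega)]
    simp
  let c : ℝ := ∑ j ∈ Finset.range n0, (mu q hq).real (A j) - Qnk q k n0
  have hpQ : ∀ n ≥ n0, ∑ j ∈ Finset.range n, (mu q hq).real (A j) = Qnk q k n + c := by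
    intro n hn
    induction n, hn using Nat.le_induction with
    | base => simp [c]
    | succ n hn ih =>
      have : Qnk q k (n + 1) = Qnk q k n + 1 / ∏ i ∈ Finset.range k, (q (n + i) : ℝ) := by
        simp [Qnk, Finset.sum_range_succ]
      rw [Finset.sum_range_succ, ih, hpj n hn, this]
      ring
  have hpQ' : ∀ᶠ n in atTop, ∑ j ∈ Finset.range n, (mu q hq).real (A j) = Qnk q k n + c :=
    eventually_atTop.2 ⟨n0, hpQ⟩
  have hdiv : Tendsto (fun n => ∑ j ∈ Finset.range n, (mu q hq).real (A j)) atTop atTop :=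
    (tendsto_atTop_add_const_right _ c hfull).congr' (hpQ'.mono fun n h => h.symm)
  filter_upwards [aux_slln (mu q hq) A hA k (fun i j h => blk_indep q hq k b i j h) hdiv] with ω hω
  have hbc : ∀ n, (blockCount ω k B n : ℝ) =
      ∑ j ∈ Finset.range (n + 1 - k), (A j).indicator (1 : (ℕ → ℕ) → ℝ) ω := by
    intro n
    unfold blockCount
    rw [Finset.card_filter, Nat.cast_sum]
    refine Finset.sum_congr rfl fun j _ => ?_
    have hiff : (∀ i : Fin k, ω (j + i) = B i) ↔ ω ∈ A j := by
      simp only [A, Set.mem_ofPred_eq]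
      constructor
      · intro h i hi
        have := h ⟨i, hi⟩
        simpa [b, hi] using this
      · intro h i
        have := h i i.2
        simpa [b] using this
    by_cases h : ω ∈ A j
    · simp [h, hiff]
    · simp [h, hiff]
  have hind01 : ∀ i, 0 ≤ (A i).indicator (1 : (ℕ → ℕ) → ℝ) ω ∧
      (A i).indicator (1 : (ℕ → ℕ) → ℝ) ω ≤ 1 := by
    intro i
    by_cases h : ω ∈ A i <;> simp [h]
  have hstep : ∀ l n : ℕ, ∑ j ∈ Finset.range (n + l), (A j).indicator (1 : (ℕ → ℕ) → ℝ) ω ≤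
      ∑ j ∈ Finset.range n, (A j).indicator (1 : (ℕ → ℕ) → ℝ) ω + l := by
    intro l n
    rw [Finset.sum_range_add]
    have : ∑ x ∈ Finset.range l, (A (n + x)).indicator (1 : (ℕ → ℕ) → ℝ) ω ≤
        ∑ x ∈ Finset.range l, (1 : ℝ) := Finset.sum_le_sum fun i _ => (hind01 _).2
    simp only [Finset.sum_const, Finset.card_range, nsmul_eq_mul, mul_one] at this
    linarith
  have hmono : ∀ a b : ℕ, a ≤ b → ∑ j ∈ Finset.range a, (A j).indicator (1 : (ℕ → ℕ) → ℝ) ω ≤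
      ∑ j ∈ Finset.range b, (A j).indicator (1 : (ℕ → ℕ) → ℝ) ω := fun a b h =>
    Finset.sum_le_sum_of_subset_of_nonneg (Finset.range_subset_range.2 h) fun i _ _ => (hind01 i).1
  rcases Nat.eq_zero_or_pos k with hk | hk
  · subst hk
    refine aux_ratio (fun n => ∑ j ∈ Finset.range n, (A j).indicator (1 : (ℕ → ℕ) → ℝ) ω + 1) _ _ _ c 1
      hpQ' hfull ?_ ?_ ?_
    · have := hω.add (hdiv.const_div_atTop 1)
      rw [add_zero] at this
      exact this.congr fun n => by rw [← add_div]
    · intro n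
      rw [hbc]
      have := hstep 1 n
      simpa using this
    · intro n
      rw [hbc]
      have := hmono n (n + 1) (by omega)
      simpa using this
  · refine aux_ratio _ _ _ _ c k hpQ' hfull hω ?_ ?_
    · intro n
      rw [hbc]
      exact hmono _ _ (by omega)
    · intro n
      rw [hbc]
      have h1 := hstep k (n + 1 - k)
      have h2 := hmono n (n + 1 - k + k) (by omega)
      linarith

theorem ae_mem (q : ℕ → ℕ) (hq : ∀ n, 2 ≤ q n) (hlim : Tendsto q atTop atTop)
    (hfull : ∀ k : ℕ, 1 ≤ k → Tendsto (fun n => Qnk q k n) atTop atTop) :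
    ∀ᵐ ω ∂(mu q hq), cval q ω ∈ ({x : ℝ | ∀ k : ℕ, 1 ≤ k → QNormalOrder q k x} \
        {x : ℝ | QDistNormal q x}) := by
  have h1 : ∀ᵐ ω ∂(mu q hq), ∀ k : ℕ, ∀ B : Fin k → ℕ, 1 ≤ k →
      Tendsto (fun n => (blockCount ω k B n : ℝ) / Qnk q k n) atTop (nhds 1) := by
    rw [ae_all_iff]
    intro k
    rw [ae_all_iff]
    intro B
    by_cases hk : 1 ≤ k
    · filter_upwards [ae_block q hq hlim k (hfull k hk) B] with ω h _ using h
    · exact Eventually.of_forall fun _ h => absurd h hk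
  filter_upwards [h1, mu_good q hq] with ω h2 h3
  refine ⟨fun k hk => ⟨ω, good_exp hq hlim h3, fun B => h2 k B hk⟩, good_not_dist hq hlim h3⟩

theorem mu_initial (q : ℕ → ℕ) (hq : ∀ n, 2 ≤ q n) (n : ℕ) (v : ℤ) :
    mu q hq {ω | GoodDig q ω ∧ (cN q ω n : ℤ) = v} ≤
      ENNReal.ofReal (2 ^ n / cantorProd q n) := by
  by_cases hex : ∃ ω0, GoodDig q ω0 ∧ (cN q ω0 n : ℤ) = v
  · obtain ⟨ω0, h0, h1⟩ := hex
    have hsub : {ω | GoodDig q ω ∧ (cN q ω n : ℤ) = v} ⊆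
        {ω | ∀ m ∈ Finset.range n, ω m = ω0 m} := by
      rintro ω ⟨h2, h3⟩ m hm
      refine cN_inj h2.lt h0.lt n ?_ m (Finset.mem_range.1 hm)
      have := h3.trans h1.symm
      exact_mod_cast this
    refine (measure_mono hsub).trans ?_
    rw [mu_cyl]
    calc ∏ m ∈ Finset.range n, wt (q m) (ω0 m)
        ≤ ∏ m ∈ Finset.range n, ENNReal.ofReal (2 / q m) := by
          refine Finset.prod_le_prod' fun m _ => (wt_le _ _).trans (le_of_eq ?_)
          have : (0 : ℝ) < q m := by have := hq m; positivity
          rw [ENNReal.ofReal_div_of_pos this, ENNReal.ofReal_natCast, div_eq_mul_inv]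
          simp
      _ = ENNReal.ofReal (2 ^ n / cantorProd q n) := by
          rw [← ENNReal.ofReal_prod_of_nonneg fun i _ => by positivity, Finset.prod_div_distrib]
          simp [cantorProd]
  · have : {ω | GoodDig q ω ∧ (cN q ω n : ℤ) = v} = ∅ := by
      ext ω
      simp only [Set.mem_ofPred_eq, Set.mem_empty_iff_false, iff_false]
      exact fun h => hex ⟨ω, h⟩
    rw [this]
    simp

theorem mu_interval (q : ℕ → ℕ) (hq : ∀ n, 2 ≤ q n) (n : ℕ) (a l : ℝ) (hl : 0 ≤ l) :
    mu q hq {ω | cval q ω ∈ Set.Icc a (a + l)} ≤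
      ENNReal.ofReal ((l * cantorProd q n + 2) * (2 ^ n / cantorProd q n)) := by
  have hP := cP_pos hq n
  let F : Finset ℤ := Finset.Icc ⌈a * cantorProd q n - 1⌉ ⌊(a + l) * cantorProd q n⌋
  have hsub : {ω | cval q ω ∈ Set.Icc a (a + l)} ⊆
      {ω | ¬ GoodDig q ω} ∪ ⋃ v ∈ F, {ω | GoodDig q ω ∧ (cN q ω n : ℤ) = v} := by
    intro ω hω
    by_cases hg : GoodDig q ω
    · right
      simp only [Set.mem_iUnion]
      refine ⟨(cN q ω n : ℤ), ?_, hg, rfl⟩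
      have h1 := cval_split hq hg.lt n
      have h2 := cval_nonneg (q := fun i => q (i + n)) (fun i => hq _) (fun i => ω (i + n))
      have h3 := cval_le_one (q := fun i => q (i + n)) (E := fun i => ω (i + n))
        (fun i => hq _) (fun i => hg.lt _)
      obtain ⟨h4, h5⟩ := hω
      rw [Finset.mem_Icc, Int.ceil_le, Int.le_floor]
      push_cast
      constructor <;> nlinarith
    · left; exact hg
  have hcard : ((F.card : ℕ) : ℝ) ≤ l * cantorProd q n + 2 := by
    have e : (F.card : ℤ) = max (⌊(a + l) * cantorProd q n⌋ + 1 - ⌈a * cantorProd q n - 1⌉) 0 := by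
      simp [F]
    have e2 : ((F.card : ℕ) : ℝ) =
        max ((⌊(a + l) * cantorProd q n⌋ : ℝ) + 1 - (⌈a * cantorProd q n - 1⌉ : ℝ)) 0 := by
      exact_mod_cast congrArg (Int.cast : ℤ → ℝ) e
    rw [e2]
    refine max_le ?_ (by positivity)
    have h1 := Int.floor_le ((a + l) * cantorProd q n)
    have h2 := Int.le_ceil (a * cantorProd q n - 1)
    nlinarith
  calc mu q hq {ω | cval q ω ∈ Set.Icc a (a + l)}
      ≤ mu q hq {ω | ¬ GoodDig q ω} +
        mu q hq (⋃ v ∈ F, {ω | GoodDig q ω ∧ (cN q ω n : ℤ) = v}) :=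
        (measure_mono hsub).trans (measure_union_le _ _)
    _ ≤ 0 + ∑ v ∈ F, ENNReal.ofReal (2 ^ n / cantorProd q n) := by
        refine add_le_add (le_of_eq (mu_good q hq)) ((measure_biUnion_finset_le _ _).trans ?_)
        exact Finset.sum_le_sum fun v _ => mu_initial q hq n v
    _ = ENNReal.ofReal (F.card * (2 ^ n / cantorProd q n)) := by
        rw [zero_add, Finset.sum_const, nsmul_eq_mul, ENNReal.ofReal_mul (Nat.cast_nonneg _),
          ENNReal.ofReal_natCast]
    _ ≤ _ := ENNReal.ofReal_le_ofReal (by gcongr)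

theorem two_pow_le (q : ℕ → ℕ) (hq : ∀ n, 2 ≤ q n) (hlim : Tendsto q atTop atTop) (e : ℝ)
    (he : 0 < e) : ∃ C : ℝ, 0 < C ∧ ∀ n, (2 : ℝ) ^ n ≤ C * cantorProd q n ^ e := by
  have h1 : Tendsto (fun n => ((q n : ℕ) : ℝ) ^ e) atTop atTop :=
    (tendsto_rpow_atTop he).comp (tendsto_natCast_atTop_atTop.comp hlim)
  obtain ⟨n0, hn0⟩ := eventually_atTop.1 (h1.eventually_ge_atTop 2)
  have hP1 : ∀ n, 1 ≤ cantorProd q n ^ e := fun n => by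
    refine Real.one_le_rpow ?_ he.le
    unfold cantorProd
    have : 1 ≤ ∏ i ∈ Finset.range n, q i :=
      Nat.succ_le_of_lt (Finset.prod_pos fun i _ => lt_of_lt_of_le two_pos (hq i))
    exact_mod_cast this
  refine ⟨2 ^ n0, by positivity, fun n => ?_⟩
  rcases le_total n n0 with h | h
  · calc (2 : ℝ) ^ n ≤ 2 ^ n0 := pow_le_pow_right₀ (by norm_num) h
      _ ≤ 2 ^ n0 * cantorProd q n ^ e := le_mul_of_one_le_right (by positivity) (hP1 n)
  · induction n, h using Nat.le_induction with
    | base => exact le_mul_of_one_le_right (by positivity) (hP1 n0)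
    | succ n hn ih =>
      rw [cP_succ, Real.mul_rpow (cP_pos hq n).le (Nat.cast_nonneg _), pow_succ, ← mul_assoc]
      exact mul_le_mul ih (hn0 n hn) (by norm_num) (by have := cP_pos hq n; positivity)

theorem cP_tendsto (q : ℕ → ℕ) (hq : ∀ n, 2 ≤ q n) : Tendsto (cantorProd q) atTop atTop := by
  refine tendsto_atTop_mono (fun n => ?_) (tendsto_pow_atTop_atTop_of_one_lt (r := (2 : ℝ))
    (by norm_num))
  have : ∏ i ∈ Finset.range n, (2 : ℝ) ≤ cantorProd q n :=
    Finset.prod_le_prod (fun _ _ => by norm_num) fun i _ => by exact_mod_cast hq i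
  simpa using this

theorem mu_holder (q : ℕ → ℕ) (hq : ∀ n, 2 ≤ q n) (hlim : Tendsto q atTop atTop) (s : ℝ)
    (hs : s < 1) : ∃ C : ℝ, 0 < C ∧ ∀ a l : ℝ, 0 < l → l < 1 →
      mu q hq {ω | cval q ω ∈ Set.Icc a (a + l)} ≤ ENNReal.ofReal (C * l ^ s) := by
  obtain ⟨C, hC, hC2⟩ := two_pow_le q hq hlim (1 - s) (by linarith)
  refine ⟨6 * C, by positivity, fun a l hl hl1 => ?_⟩
  have hex : ∃ n, 1 ≤ l * cantorProd q n :=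
    (((cP_tendsto q hq).const_mul_atTop hl).eventually_ge_atTop 1).exists
  have hspec := Nat.find_spec hex
  have hmin : ∀ m < Nat.find hex, l * cantorProd q m < 1 := fun m hm => by
    simpa using Nat.find_min hex hm
  obtain ⟨n, hn⟩ : ∃ n, Nat.find hex = n + 1 := by
    refine ⟨Nat.find hex - 1, ?_⟩
    have : Nat.find hex ≠ 0 := fun h => by
      rw [h] at hspec
      simp [cantorProd] at hspec
      linarith
    omega
  have h1 := hmin n (by omega)
  rw [hn] at hspec
  refine (mu_interval q hq (n + 1) a l hl.le).trans (ENNReal.ofReal_le_ofReal ?_)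
  have hPn := cP_pos hq n
  have hPs := cP_pos hq (n + 1)
  calc (l * cantorProd q (n + 1) + 2) * (2 ^ (n + 1) / cantorProd q (n + 1))
      ≤ (3 * (l * cantorProd q (n + 1))) * (2 ^ (n + 1) / cantorProd q (n + 1)) := by
        gcongr; linarith
    _ = 6 * l * 2 ^ n := by field_simp; ring
    _ ≤ 6 * l * (C * cantorProd q n ^ (1 - s)) := by gcongr; exact hC2 n
    _ ≤ 6 * l * (C * (l⁻¹) ^ (1 - s)) := by
        have : cantorProd q n ≤ l⁻¹ := by
          rw [← one_div, le_div_iff₀ hl]; linarith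
        gcongr
    _ = 6 * C * l ^ s := by
        rw [Real.inv_rpow hl.le, ← Real.rpow_neg hl.le]
        have : l ^ s = l * l ^ (-(1 - s)) := by
          nth_rewrite 2 [← Real.rpow_one l]
          rw [← Real.rpow_add hl]
          congr 1
          ring
        rw [this]
        ring

theorem cval_aemeas (q : ℕ → ℕ) (hq : ∀ n, 2 ≤ q n) : AEMeasurable (cval q) (mu q hq) := by
  refine aemeasurable_of_tendsto_metrizable_ae' (f := fun M ω =>
    ∑ n ∈ Finset.range M, ((ω n : ℕ) : ℝ) / cantorProd q (n + 1)) (fun M => ?_) ?_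
  · refine (Finset.measurable_sum _ fun n _ => ?_).aemeasurable
    exact ((measurable_from_nat (f := fun x : ℕ => (x : ℝ))).comp
      (measurable_pi_apply n)).div_const _
  · filter_upwards [mu_good q hq] with ω h
    exact (cval_summable hq h.lt).hasSum.tendsto_sum_nat

theorem dim_lower (q : ℕ → ℕ) (hq : ∀ n, 2 ≤ q n) (hlim : Tendsto q atTop atTop) (T : Set ℝ)
    (hT : ∀ᵐ ω ∂(mu q hq), cval q ω ∈ T) (s : NNReal) (hs0 : 0 < s) (hs : s < 1) :
    (s : ENNReal) ≤ dimH T := by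
  obtain ⟨C, hC, hC2⟩ := mu_holder q hq hlim s (by exact_mod_cast hs)
  have hsr : (0 : ℝ) < s := by exact_mod_cast hs0
  let ν : Measure ℝ := (mu q hq).map (cval q)
  have hν : ∀ a l : ℝ, 0 < l → l < 1 → ν (Set.Icc a (a + l)) ≤ ENNReal.ofReal (C * l ^ (s : ℝ)) := by
    intro a l h0 h1
    rw [Measure.map_apply_of_aemeasurable (cval_aemeas q hq) measurableSet_Icc]
    exact hC2 a l h0 h1
  have hνT : ν T ≠ 0 := by
    have h1 := Measure.le_map_apply (cval_aemeas q hq) T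
    have h2 : mu q hq (cval q ⁻¹' T) = 1 := by
      rw [← prob_compl_eq_zero_iff₀]
      · exact hT
      · exact NullMeasurableSet.of_compl (NullMeasurableSet.of_null hT)
    rw [h2] at h1
    exact (lt_of_lt_of_le one_pos h1).ne'
  let K : ℝ := C * 2 ^ (s : ℝ)
  have hK : 0 < K := by positivity
  have hbound : ∀ S : Set ℝ, Metric.ediam S ≤ ENNReal.ofReal (1 / 4) →
      ν S ≤ ENNReal.ofReal K * Metric.ediam S ^ (s : ℝ) := by
    intro S hS
    rcases S.eq_empty_or_nonempty with rfl | ⟨x, hx⟩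
    · simp
    have hfin : Metric.ediam S ≠ ⊤ := ne_top_of_le_ne_top ENNReal.ofReal_ne_top hS
    set D := (Metric.ediam S).toReal with hD
    have hDle : D ≤ 1 / 4 := ENNReal.toReal_le_of_le_ofReal (by norm_num) hS
    have hdD : Metric.ediam S = ENNReal.ofReal D := (ENNReal.ofReal_toReal hfin).symm
    have hD0 : 0 ≤ D := ENNReal.toReal_nonneg
    have hsub : ∀ l, D ≤ l → S ⊆ Set.Icc (x - l) ((x - l) + 2 * l) := by
      intro l hl y hy
      have h1 : edist y x ≤ ENNReal.ofReal D := hdD ▸ Metric.edist_le_ediam_of_mem hy hx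
      rw [edist_dist, ENNReal.ofReal_le_ofReal_iff hD0, Real.dist_eq, abs_le] at h1
      constructor <;> linarith [h1.1, h1.2]
    rcases hD0.eq_or_lt with h0 | h0
    · have : ν S ≤ 0 := by
        have ht : Tendsto (fun n : ℕ => ENNReal.ofReal (C * (2 * (1 / ((n : ℝ) + 3))) ^ (s : ℝ)))
            atTop (nhds 0) := by
          have h1 : Tendsto (fun n : ℕ => 1 / ((n : ℝ) + 3)) atTop (nhds 0) := by
            have := (tendsto_add_atTop_iff_nat 3).2 (tendsto_one_div_atTop_nhds_zero_nat (𝕜 := ℝ))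
            simpa using this
          have h2 := ((h1.const_mul 2).rpow_const (Or.inr hsr.le) (p := (s : ℝ))).const_mul C
          have h3 := ENNReal.tendsto_ofReal h2
          simpa [Real.zero_rpow hsr.ne'] using h3
        refine ge_of_tendsto' ht fun n => ?_
        have hp : (0 : ℝ) < n + 3 := by positivity
        refine (measure_mono (hsub (1 / ((n : ℝ) + 3)) (by rw [← h0]; positivity))).trans
          (hν _ _ (by positivity) ?_)
        rw [mul_one_div, div_lt_one hp]
        have : (0 : ℝ) ≤ n := Nat.cast_nonneg n
        linarith
      exact this.trans zero_le
    · refine (measure_mono (hsub D le_rfl)).trans ((hν _ _ (by linarith) (by linarith)).trans ?_)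
      rw [hdD, ENNReal.ofReal_rpow_of_pos h0, ← ENNReal.ofReal_mul hK.le,
        Real.mul_rpow (by norm_num) h0.le, ← mul_assoc]
  have hKne : ENNReal.ofReal K ≠ 0 := by simpa using hK
  have hle : (ENNReal.ofReal K)⁻¹ • ν ≤ Measure.hausdorffMeasure (s : ℝ) := by
    refine Measure.le_hausdorffMeasure _ _ (ENNReal.ofReal (1 / 4)) (by simp) fun S hS => ?_
    rw [Measure.smul_apply, smul_eq_mul]
    calc (ENNReal.ofReal K)⁻¹ * ν S
        ≤ (ENNReal.ofReal K)⁻¹ * (ENNReal.ofReal K * Metric.ediam S ^ (s : ℝ)) := by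
          gcongr; exact hbound S hS
      _ = Metric.ediam S ^ (s : ℝ) := by
          rw [← mul_assoc, ENNReal.inv_mul_cancel hKne ENNReal.ofReal_ne_top, one_mul]
  refine le_dimH_of_hausdorffMeasure_ne_zero fun h0 => ?_
  have h1 := hle T
  rw [h0, Measure.smul_apply, smul_eq_mul, nonpos_iff_eq_zero, mul_eq_zero] at h1
  rcases h1 with h1 | h1
  · exact ENNReal.ofReal_ne_top (ENNReal.inv_eq_zero.1 h1)
  · exact hνT h1

/-- For `Q = Q(α, β, s, t, υ)` infinite in limit, fully divergent, and
satisfying conditions (2.2), (2.3), (3.1) for all `k`, (3.3), (3.4), with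
`α_i = o(β_i)`, the set `N(Q) \ DN(Q)` has full Hausdorff dimension. -/
theorem dimH_N_diff_DN (α β s t υ : ℕ → ℕ) (q : ℕ → ℕ)
    (hα : ∀ i, 2 ≤ α i) (hβ : ∀ i, 2 ≤ β i) (hq : ∀ n, 2 ≤ q n)
    (hQ : IsQConcat α β s t υ q)
    (hlim : Tendsto q atTop atTop)
    (hfull : ∀ k : ℕ, 1 ≤ k → Tendsto (fun n => Qnk q k n) atTop atTop)
    (h1 : Tendsto (fun n => (s n : ℝ) * Real.log (α n) /
        ∑ i ∈ Finset.range n, (υ i : ℝ) * t i * Real.log (β i))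
      atTop (nhds 0))
    (h2 : Tendsto (fun n => (s n : ℝ) * Real.log (α n) /
        ((t n : ℝ) * Real.log (β n))) atTop (nhds 0))
    (h3 : ∀ k : ℕ, 1 ≤ k → Tendsto
      (fun n => (t n : ℝ) * (α n : ℝ) ^ k / ((s n : ℝ) * (β n : ℝ) ^ k))
      atTop (nhds 0))
    (h4 : ∀ k : ℕ, 1 ≤ k →
      Tendsto (fun n => (α n : ℝ) ^ k / (s n : ℝ)) atTop (nhds 0))
    (h5 : Tendsto (fun n =>
        (∑ i ∈ Finset.range (n + 1), (υ i : ℝ) * s i) /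
          (∑ i ∈ Finset.range (n + 1), (υ i : ℝ) * (s i + t i)))
      atTop (nhds 0))
    (h6 : Tendsto (fun n => (α n : ℝ) / (β n : ℝ)) atTop (nhds 0)) :
    dimH ({x : ℝ | ∀ k : ℕ, 1 ≤ k → QNormalOrder q k x} \
        {x : ℝ | QDistNormal q x}) = 1 := by
  refine le_antisymm ((dimH_mono (Set.subset_univ _)).trans_eq Real.dimH_univ) ?_
  have hT := ae_mem q hq hlim hfull
  refine le_of_forall_lt fun c hc => ?_
  obtain ⟨r, hr1, hr2⟩ := ENNReal.lt_iff_exists_nnreal_btwn.1 hc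
  have hr0 : 0 < r := by
    have := lt_of_le_of_lt (zero_le (a := c)) hr1
    exact_mod_cast this
  exact lt_of_lt_of_le hr1 (dim_lower q hq hlim _ hT r hr0 (by exact_mod_cast hr2))
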